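/- arXiv:1908.08198 — 9 statements merged into one kernel-verified Lean document; each statement's English description precedes it below -/
import Mathlib

section
/- Let G be a connected simple graph on a finite vertex type V with n = |V| ≥ 1, and let μ : L_G → ℤ be the Möbius function of the bond lattice L_G of G. Then the chromatic symmetric function of G satisfies X_G = Σ_{π ∈ L_G} μ(π) · p_{type(π)}, an identity in MvPowerSeries ℕ ℤ. -/
open scoped Classical

/-- The chromatic symmetric function of a simple graph `G` on a finite vertex type `V`:
the formal power series in variables `x_i` (`i : ℕ`) whose coefficient at the monomial
`∏ i, x_i ^ d i` is the number of proper colorings `κ : V → ℕ` with `|κ⁻¹(i)| = d i`. -/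
noncomputable def chromSym {V : Type*} [Fintype V] (G : SimpleGraph V) :
    MvPowerSeries ℕ ℤ :=
  fun d : ℕ →₀ ℕ =>
    (Nat.card {κ : V → ℕ // (∀ u v, G.Adj u v → κ u ≠ κ v) ∧
      ∀ i : ℕ, Nat.card {v : V // κ v = i} = d i} : ℤ)

/-- The `r`-th power sum symmetric function `p_r = ∑ i, x_i ^ r` in `MvPowerSeries ℕ ℤ`. -/
noncomputable def powerSum (r : ℕ) : MvPowerSeries ℕ ℤ :=
  fun d : ℕ →₀ ℕ => if ∃ i : ℕ, d = Finsupp.single i r then 1 else 0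

/-- The content of a coloring, as an exponent vector. -/
noncomputable def contentOf {V : Type*} [Fintype V] (κ : V → ℕ) : ℕ →₀ ℕ :=
  ∑ v, Finsupp.single (κ v) 1

lemma contentOf_apply {V : Type*} [Fintype V] (κ : V → ℕ) (i : ℕ) :
    contentOf κ i = Nat.card {v : V // κ v = i} := by
  rw [Nat.card_eq_fintype_card, Fintype.card_subtype, contentOf, Finsupp.finsetSum_apply,
    Finset.card_filter]
  simp only [Finsupp.single_apply]

/-- The colorings with content `d`. -/
noncomputable def colorings (V : Type*) [Fintype V] (d : ℕ →₀ ℕ) : Finset (V → ℕ) :=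
  (Fintype.piFinset (fun _ : V => d.support)).filter fun κ => contentOf κ = d

lemma mem_colorings {V : Type*} [Fintype V] (d : ℕ →₀ ℕ) (κ : V → ℕ) :
    κ ∈ colorings V d ↔ contentOf κ = d := by
  simp only [colorings, Finset.mem_filter, Fintype.mem_piFinset, and_iff_right_iff_imp]
  rintro rfl v
  rw [Finsupp.mem_support_iff, contentOf_apply]
  have : Nonempty {w : V // κ w = κ v} := ⟨⟨v, rfl⟩⟩
  exact Nat.pos_iff_ne_zero.1 Nat.card_pos

/-- `κ` is constant on the blocks of `π`. -/
def ConstOn {V : Type*} [Fintype V] [DecidableEq V] (κ : V → ℕ)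
    (π : Finpartition (Finset.univ : Finset V)) : Prop :=
  ∀ B ∈ π.parts, ∀ u ∈ B, ∀ v ∈ B, κ u = κ v

lemma sum_block {V : Type*} [Fintype V] [DecidableEq V] (κ : V → ℕ)
    (B : Finset V) (v : V) (h : ∀ u ∈ B, κ u = κ v) :
    ∑ u ∈ B, Finsupp.single (κ u) 1 = Finsupp.single (κ v) B.card := by
  rw [Finset.sum_congr rfl (fun u hu => by rw [h u hu]), Finset.sum_const]
  simp

lemma sum_parts {V : Type*} [Fintype V] [DecidableEq V] (κ : V → ℕ)
    (π : Finpartition (Finset.univ : Finset V)) :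
    ∑ B ∈ π.parts, ∑ u ∈ B, Finsupp.single (κ u) 1 = contentOf κ := by
  have h := Finset.sum_biUnion (f := fun v => Finsupp.single (κ v) 1)
    π.supIndep.pairwiseDisjoint
  rw [π.biUnion_parts] at h
  exact h.symm

lemma coeff_prod_powerSum {V : Type*} [Fintype V] [DecidableEq V]
    (π : Finpartition (Finset.univ : Finset V)) (d : ℕ →₀ ℕ) :
    MvPowerSeries.coeff d (∏ B ∈ π.parts, powerSum B.card) =
      (((colorings V d).filter fun κ => ConstOn κ π).card : ℤ) := by
  have hc : ∀ (e : ℕ →₀ ℕ) (r : ℕ), MvPowerSeries.coeff e (powerSum r) =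
      if ∃ i : ℕ, e = Finsupp.single i r then 1 else 0 := fun _ _ => rfl
  rw [MvPowerSeries.coeff_prod]
  simp only [hc]
  simp only [Finset.prod_boole]
  refine Eq.trans (b := ((((π.parts.finsuppAntidiag d).filter fun x =>
    ∀ B ∈ π.parts, ∃ i : ℕ, x B = Finsupp.single i B.card).card : ℕ) : ℤ)) ?_ ?_
  · rw [Finset.card_filter, Nat.cast_sum]
    refine Finset.sum_congr rfl fun x _ => ?_
    split_ifs <;> simp
  congr 1
  symm
  refine Finset.card_bij (fun κ _ => Finsupp.onFinset π.parts
    (fun B => if B ∈ π.parts then ∑ u ∈ B, Finsupp.single (κ u) 1 else 0) ?_) ?_ ?_ ?_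
  · intro B hB
    by_contra h
    simp [h] at hB
  · intro κ hκ
    rw [Finset.mem_filter, mem_colorings] at hκ
    obtain ⟨h1, h2⟩ := hκ
    rw [Finset.mem_filter, Finset.mem_finsuppAntidiag]
    refine ⟨⟨?_, Finsupp.support_onFinset_subset⟩, ?_⟩
    · rw [← h1, ← sum_parts κ π]
      refine Finset.sum_congr rfl fun B hB => ?_
      simp [hB]
    · intro B hB
      obtain ⟨v, hv⟩ := π.nonempty_of_mem_parts hB
      refine ⟨κ v, ?_⟩
      rw [← sum_block κ B v (fun u hu => h2 B hB u hu v hv)]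
      simp [hB]
  · intro κ hκ κ' hκ' h
    rw [Finset.mem_filter] at hκ hκ'
    funext v
    have hB : π.part v ∈ π.parts := π.part_mem.2 (Finset.mem_univ v)
    have hv : v ∈ π.part v := π.mem_part (Finset.mem_univ v)
    have := DFunLike.congr_fun h (π.part v)
    simp only [Finsupp.onFinset_apply, if_pos hB] at this
    rw [sum_block κ _ v (fun u hu => hκ.2 _ hB u hu v hv),
      sum_block κ' _ v (fun u hu => hκ'.2 _ hB u hu v hv),
      Finsupp.single_left_inj (Finset.card_pos.2 ⟨v, hv⟩).ne'] at this
    exact this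
  · intro l hl
    rw [Finset.mem_filter, Finset.mem_finsuppAntidiag] at hl
    obtain ⟨⟨h1, h2⟩, h3⟩ := hl
    choose! c hc using h3
    have hcon : ConstOn (fun v => c (π.part v)) π := by
      intro B hB u hu v hv
      simp only [π.part_eq_of_mem hB hu, π.part_eq_of_mem hB hv]
    have hs : ∀ B ∈ π.parts, ∑ u ∈ B, Finsupp.single (c (π.part u)) 1 = l B := by
      intro B hB
      obtain ⟨v, hv⟩ := π.nonempty_of_mem_parts hB
      rw [sum_block (fun v => c (π.part v)) B v (fun u hu => hcon B hB u hu v hv), hc B hB]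
      simp only [π.part_eq_of_mem hB hv]
    refine ⟨fun v => c (π.part v), ?_, ?_⟩
    · rw [Finset.mem_filter, mem_colorings]
      refine ⟨?_, hcon⟩
      rw [← sum_parts _ π, ← h1]
      exact Finset.sum_congr rfl hs
    · ext1 B
      rw [Finsupp.onFinset_apply]
      split_ifs with hB
      · exact hs B hB
      · by_contra h
        exact hB (h2 (Finsupp.mem_support_iff.2 (Ne.symm h)))

/-- The monochromatic subgraph. -/
def monoGraph {V : Type*} (G : SimpleGraph V) (κ : V → ℕ) : SimpleGraph V where
  Adj u v := G.Adj u v ∧ κ u = κ v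
  symm := ⟨fun _ _ h => ⟨h.1.symm, h.2.symm⟩⟩
  loopless := ⟨fun _ h => h.1.ne rfl⟩

lemma monoGraph_const {V : Type*} (G : SimpleGraph V) (κ : V → ℕ) {u v : V}
    (h : (monoGraph G κ).Reachable u v) : κ u = κ v := by
  obtain ⟨p⟩ := h
  induction p with
  | nil => rfl
  | cons h _ ih => exact h.2.trans ih

/-- The partition of `V` into monochromatic components. -/
noncomputable def monoPart {V : Type*} [Fintype V] [DecidableEq V] (G : SimpleGraph V)
    (κ : V → ℕ) : Finpartition (Finset.univ : Finset V) :=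
  Finpartition.ofSetoid (monoGraph G κ).reachableSetoid

lemma mem_monoPart {V : Type*} [Fintype V] [DecidableEq V] (G : SimpleGraph V)
    (κ : V → ℕ) (u v : V) : v ∈ (monoPart G κ).part u ↔ (monoGraph G κ).Reachable u v :=
  Finpartition.mem_part_ofSetoid_iff_rel

lemma monoPart_connected {V : Type*} [Fintype V] [DecidableEq V] (G : SimpleGraph V)
    (κ : V → ℕ) (B : Finset V) (hB : B ∈ (monoPart G κ).parts) :
    (G.induce (B : Set V)).Connected := by
  obtain ⟨v, hv⟩ := (monoPart G κ).nonempty_of_mem_parts hB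
  have hBs : (B : Set V) = ((monoGraph G κ).connectedComponentMk v).supp := by
    ext w
    rw [← (monoPart G κ).part_eq_of_mem hB hv, Finset.mem_coe, mem_monoPart,
      SimpleGraph.ConnectedComponent.mem_supp_iff, SimpleGraph.ConnectedComponent.eq]
    exact SimpleGraph.reachable_comm
  rw [hBs]
  have h := ((monoGraph G κ).connectedComponentMk v).connected_toSimpleGraph
  refine SimpleGraph.Connected.mono ?_ h
  intro a b hab
  exact hab.1

lemma le_monoPart {V : Type*} [Fintype V] [DecidableEq V] (G : SimpleGraph V)
    (κ : V → ℕ) (σ : Finpartition (Finset.univ : Finset V))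
    (hσ : ∀ B ∈ σ.parts, (G.induce (B : Set V)).Connected) :
    σ ≤ monoPart G κ ↔ ConstOn κ σ := by
  constructor
  · intro h B hB u hu v hv
    obtain ⟨C, hC, hBC⟩ := h hB
    apply monoGraph_const G
    rw [← mem_monoPart, (monoPart G κ).part_eq_of_mem hC (hBC hu)]
    exact hBC hv
  · intro h B hB
    obtain ⟨u, hu⟩ := σ.nonempty_of_mem_parts hB
    refine ⟨(monoPart G κ).part u, (monoPart G κ).part_mem.2 (Finset.mem_univ u), ?_⟩
    intro v hv
    rw [mem_monoPart]
    let f : G.induce (B : Set V) →g monoGraph G κ :=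
      ⟨Subtype.val, fun {a b} hab => ⟨hab, h B hB _ a.2 _ b.2⟩⟩
    exact ((hσ B hB).preconnected ⟨u, hu⟩ ⟨v, hv⟩).map f

lemma monoPart_eq_bot {V : Type*} [Fintype V] [DecidableEq V] (G : SimpleGraph V)
    (κ : V → ℕ) : monoPart G κ = ⊥ ↔ ∀ u v, G.Adj u v → κ u ≠ κ v := by
  constructor
  · intro h u v huv hk
    have hr : (monoGraph G κ).Reachable u v :=
      SimpleGraph.Adj.reachable (G := monoGraph G κ) ⟨huv, hk⟩
    rw [← mem_monoPart] at hr
    have hp : (monoPart G κ).part u ∈ (monoPart G κ).parts :=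
      (monoPart G κ).part_mem.2 (Finset.mem_univ u)
    have hu := (monoPart G κ).mem_part (Finset.mem_univ u)
    rw [h] at hp hr hu
    obtain ⟨a, -, ha⟩ := Finpartition.mem_bot_iff.1 hp
    rw [← ha, Finset.mem_singleton] at hr hu
    exact huv.ne (hu.trans hr.symm)
  · intro h
    rw [← le_bot_iff]
    intro B hB
    obtain ⟨u, hu⟩ := (monoPart G κ).nonempty_of_mem_parts hB
    refine ⟨{u}, Finpartition.mem_bot_iff.2 ⟨u, Finset.mem_univ u, rfl⟩, ?_⟩
    intro v hv
    rw [← (monoPart G κ).part_eq_of_mem hB hu, mem_monoPart] at hv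
    obtain ⟨p⟩ := hv
    cases p with
    | nil => simp
    | cons hh _ => exact absurd hh.2 (h _ _ hh.1)

/-- Stanley's theorem: `X_G = ∑_{π ∈ L_G} μ(π) p_{type(π)}`, where `L_G` is the bond lattice
of `G` (partitions of the vertex set all of whose blocks induce connected subgraphs, ordered
by refinement), `μ` is its Möbius function, and `p_{type(π)} = ∏_{B ∈ π} p_{|B|}`. -/
theorem stmt0 {V : Type*} [Fintype V] [DecidableEq V] (G : SimpleGraph V)
    (hG : G.Connected) (hn : 1 ≤ Fintype.card V)
    (L : Finset (Finpartition (Finset.univ : Finset V)))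
    (hL : ∀ π : Finpartition (Finset.univ : Finset V),
      π ∈ L ↔ ∀ B ∈ π.parts, (G.induce (B : Set V)).Connected)
    (μ : Finpartition (Finset.univ : Finset V) → ℤ)
    (hμ : ∀ π ∈ L, (∑ σ ∈ L.filter fun σ => σ ≤ π, μ σ) = if π = ⊥ then 1 else 0) :
    chromSym G = ∑ π ∈ L, μ π • ∏ B ∈ π.parts, powerSum B.card := by
  have hmain : ∀ d : ℕ →₀ ℕ, MvPowerSeries.coeff d (chromSym G) =
      MvPowerSeries.coeff d (∑ π ∈ L, μ π • ∏ B ∈ π.parts, powerSum B.card) := by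
    intro d
    have hleft : MvPowerSeries.coeff d (chromSym G) =
        (((colorings V d).filter fun κ => ∀ u v, G.Adj u v → κ u ≠ κ v).card : ℤ) := by
      change ((Nat.card {κ : V → ℕ // (∀ u v, G.Adj u v → κ u ≠ κ v) ∧
        ∀ i : ℕ, Nat.card {v : V // κ v = i} = d i} : ℕ) : ℤ) = _
      congr 1
      refine Nat.subtype_card _ fun κ => ?_
      rw [Finset.mem_filter, mem_colorings, and_comm, DFunLike.ext_iff]
      simp only [contentOf_apply]
    rw [hleft, map_sum]
    simp only [map_zsmul, coeff_prod_powerSum, Finset.card_filter, Nat.cast_sum, smul_eq_mul,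
      Finset.mul_sum, Nat.cast_ite, Nat.cast_one, Nat.cast_zero]
    rw [Finset.sum_comm]
    refine Finset.sum_congr rfl fun κ _ => ?_
    have h1 := hμ (monoPart G κ) ((hL _).2 (monoPart_connected G κ))
    rw [Finset.sum_filter] at h1
    simp only [monoPart_eq_bot] at h1
    rw [← h1]
    refine Finset.sum_congr rfl fun σ hσ => ?_
    simp only [le_monoPart G κ σ ((hL σ).1 hσ), mul_ite, mul_one, mul_zero]
  exact MvPowerSeries.ext hmain
end

section
/- Let G be a connected simple graph on a finite vertex type V with n = |V| ≥ 1. Suppose c : Partition n → ℤ is a family of integers such that X_G = Σ_{λ ⊢ n} c(λ) · p_λ in MvPowerSeries ℕ ℤ, and let P ∈ ℤ[q] be the chromatic polynomial of G, i.e. for every natural number q, P evaluated at q equals the number of proper colorings κ : V → Fin q of G. Then |c((n))| = |P.coeff 1|, where (n) denotes the partition of n with the single part n; that is, the absolute value of the coefficient of p_(n) in X_G equals the chromatic discriminant of G. -/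
open scoped Classical

noncomputable def specVar (q : ℕ) : ℕ → MvPowerSeries Unit ℤ :=
  fun i => if i < q then MvPowerSeries.X () else 0

theorem specVar_hasSubst (q : ℕ) : MvPowerSeries.HasSubst (specVar q) where
  const_coeff s := by
    unfold specVar
    split_ifs <;> simp
  coeff_zero d := by
    refine (Set.finite_lt_nat q).subset ?_
    intro s hs
    by_contra h
    simp only [Set.mem_ofPred_eq] at h
    simp [specVar, h] at hs

theorem specVar_prod (q : ℕ) (d : ℕ →₀ ℕ) :
    (d.prod fun s e => specVar q s ^ e) =
      if d.support ⊆ Finset.range q then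
        (MvPowerSeries.X () : MvPowerSeries Unit ℤ) ^ (d.sum fun _ e => e) else 0 := by
  split_ifs with h
  · rw [Finsupp.prod, Finsupp.sum, ← Finset.prod_pow_eq_pow_sum]
    refine Finset.prod_congr rfl fun i hi => ?_
    have := Finset.mem_range.1 (h hi)
    simp [specVar, this]
  · obtain ⟨i, hi, hi'⟩ := Finset.not_subset.1 h
    refine Finset.prod_eq_zero hi ?_
    have h1 : ¬ i < q := by simpa using hi'
    simp [specVar, h1, Finsupp.mem_support_iff.1 hi]

theorem coeff_spec (q m : ℕ) (f : MvPowerSeries ℕ ℤ) :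
    MvPowerSeries.coeff (Finsupp.single () m) (MvPowerSeries.subst (specVar q) f) =
      ∑ d ∈ Finset.finsuppAntidiag (Finset.range q) m, MvPowerSeries.coeff d f := by
  have key : ∀ d : ℕ →₀ ℕ, MvPowerSeries.coeff d f • MvPowerSeries.coeff (Finsupp.single () m)
      (d.prod fun s e => specVar q s ^ e) =
      if d ∈ Finset.finsuppAntidiag (Finset.range q) m then MvPowerSeries.coeff d f else 0 := by
    intro d
    rw [specVar_prod]
    simp only [Finset.mem_finsuppAntidiag']
    by_cases h : d.support ⊆ Finset.range q
    · simp only [h, if_true, and_true, MvPowerSeries.coeff_X_pow]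
      by_cases h2 : (d.sum fun _ e => e) = m
      · simp [h2]
      · have h3 : Finsupp.single () m ≠ Finsupp.single () (d.sum fun _ e => e) := by
          intro h4
          exact h2 (Finsupp.single_injective _ h4).symm
        rw [if_neg h3, if_neg h2]; simp
    · simp [h]
  rw [MvPowerSeries.coeff_subst (specVar_hasSubst q)]
  rw [finsum_congr key, finsum_eq_sum_of_support_subset]
  · exact Finset.sum_congr rfl fun d hd => if_pos hd
  · intro d hd
    by_contra h
    exact hd (if_neg h)

theorem spec_powerSum (q r : ℕ) (hr : 0 < r) :
    MvPowerSeries.subst (specVar q) (powerSum r) =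
      MvPowerSeries.monomial (Finsupp.single () r) (q : ℤ) := by
  refine MvPowerSeries.ext fun e => ?_
  obtain ⟨m, rfl⟩ : ∃ m, e = Finsupp.single () m := ⟨e (), by ext; simp⟩
  rw [coeff_spec, MvPowerSeries.coeff_monomial]
  have h0 : ∀ d, MvPowerSeries.coeff d (powerSum r) =
    if ∃ i : ℕ, d = Finsupp.single i r then 1 else 0 := fun d => rfl
  simp only [h0]
  rw [← Finset.sum_filter, Finset.sum_const, nsmul_eq_mul, mul_one]
  by_cases h : m = r
  · subst h
    rw [if_pos rfl]
    norm_cast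
    have : (Finset.finsuppAntidiag (Finset.range q) m).filter
        (fun d => ∃ i : ℕ, d = Finsupp.single i m) =
        (Finset.range q).image (fun i => Finsupp.single i m) := by
      ext d
      simp only [Finset.mem_filter, Finset.mem_finsuppAntidiag', Finset.mem_image]
      constructor
      · rintro ⟨⟨_, h2⟩, i, rfl⟩
        refine ⟨i, h2 ?_, rfl⟩
        simp [hr.ne']
      · rintro ⟨i, hi, rfl⟩
        refine ⟨⟨by simp, ?_⟩, i, rfl⟩
        rw [Finsupp.support_single_ne_zero _ hr.ne']
        simpa using hi
    rw [this, Finset.card_image_of_injective, Finset.card_range]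
    exact Finsupp.single_left_injective hr.ne'
  · have h3 : Finsupp.single () m ≠ Finsupp.single () r := fun h4 =>
      h (Finsupp.single_injective _ h4)
    rw [if_neg h3, Finset.filter_eq_empty_iff.2]
    · simp
    · rintro d hd ⟨i, rfl⟩
      rw [Finset.mem_finsuppAntidiag'] at hd
      apply h
      rw [← hd.1]; simp

theorem spec_prod (q : ℕ) (s : Multiset ℕ) (hs : ∀ i ∈ s, 0 < i) :
    MvPowerSeries.subst (specVar q) ((s.map powerSum).prod) =
      MvPowerSeries.monomial (Finsupp.single () s.sum) ((q : ℤ) ^ s.card) := by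
  induction s using Multiset.induction_on with
  | empty =>
    rw [← MvPowerSeries.substAlgHom_apply (specVar_hasSubst q), Multiset.map_zero, Multiset.prod_zero, map_one]
    simp
  | cons a s ih =>
    rw [Multiset.map_cons, Multiset.prod_cons, MvPowerSeries.subst_mul (specVar_hasSubst q),
      ih fun i hi => hs i (Multiset.mem_cons_of_mem hi),
      spec_powerSum q a (hs a (Multiset.mem_cons_self a s)),
      MvPowerSeries.monomial_mul_monomial, ← Finsupp.single_add, Multiset.sum_cons,
      Multiset.card_cons, pow_succ']

theorem spec_chromSym {V : Type*} [Fintype V] (G : SimpleGraph V) (q : ℕ) :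
    ∑ d ∈ Finset.finsuppAntidiag (Finset.range q) (Fintype.card V),
      MvPowerSeries.coeff d (chromSym G) =
      (Nat.card {κ : V → Fin q // ∀ u v, G.Adj u v → κ u ≠ κ v} : ℤ) := by
  have h0 : ∀ d, MvPowerSeries.coeff d (chromSym G) =
    (Nat.card {κ : V → ℕ // (∀ u v, G.Adj u v → κ u ≠ κ v) ∧
      ∀ i : ℕ, Nat.card {v : V // κ v = i} = d i} : ℤ) := fun d => rfl
  simp only [h0]
  rw [Nat.card_eq_fintype_card, Fintype.card_subtype]
  let F : (V → Fin q) → (ℕ →₀ ℕ) := fun κ => ∑ v, Finsupp.single (κ v : ℕ) 1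
  have hF : ∀ κ i, Nat.card {v : V // (κ v : ℕ) = i} = F κ i := by
    intro κ i
    rw [Nat.card_eq_fintype_card, Fintype.card_subtype, Finset.card_filter,
      Finsupp.finsetSum_apply]
    refine Finset.sum_congr rfl fun v _ => ?_
    rw [Finsupp.single_apply]
  have hmaps : ∀ κ ∈ Finset.univ.filter (fun κ : V → Fin q => ∀ u v, G.Adj u v → κ u ≠ κ v),
      F κ ∈ Finset.finsuppAntidiag (Finset.range q) (Fintype.card V) := by
    intro κ _
    have hsupp : (F κ).support ⊆ Finset.range q := by
      intro i hi
      rw [Finsupp.mem_support_iff, ← hF] at hi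
      have : Nonempty {v : V // (κ v : ℕ) = i} := (Nat.card_ne_zero.1 hi).1
      obtain ⟨v, hv⟩ := this
      rw [← hv]; simp
    rw [Finset.mem_finsuppAntidiag]
    refine ⟨?_, hsupp⟩
    simp only [F, Finsupp.finsetSum_apply]
    rw [Finset.sum_comm]
    simp [Finsupp.single_apply]
  rw [Finset.card_eq_sum_card_fiberwise hmaps]
  push_cast
  refine Finset.sum_congr rfl fun d hd => ?_
  norm_cast
  rw [Finset.filter_filter, ← Fintype.card_subtype, ← Nat.card_eq_fintype_card]
  rw [Finset.mem_finsuppAntidiag] at hd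
  symm
  refine Nat.card_congr (Equiv.ofBijective
    (fun κ => ⟨fun v => (κ.1 v : ℕ), ?_, ?_⟩) ⟨?_, ?_⟩)
  · intro u v huv h
    exact κ.2.1 u v huv (Fin.ext h)
  · intro i
    rw [hF, κ.2.2]
  · intro κ κ' h
    apply Subtype.ext
    funext v
    have := congrFun (congrArg Subtype.val h) v
    exact Fin.ext this
  · rintro ⟨κ, h1, h2⟩
    have hlt : ∀ v, κ v < q := by
      intro v
      have : κ v ∈ d.support := by
        rw [Finsupp.mem_support_iff, ← h2]
        exact Nat.card_ne_zero.2 ⟨⟨⟨v, rfl⟩⟩, inferInstance⟩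
      simpa using hd.2 this
    refine ⟨⟨fun v => ⟨κ v, hlt v⟩, ?_, ?_⟩, rfl⟩
    · intro u v huv h
      exact h1 u v huv (congrArg Fin.val h)
    · ext i
      rw [← hF, ← h2]

/-- If `X_G = ∑_{λ ⊢ n} c(λ) p_λ`, then the absolute value of the coefficient `c((n))` of
`p_{(n)}` equals the chromatic discriminant of `G`, i.e. the absolute value of the linear
coefficient of the chromatic polynomial of `G`. -/
theorem stmt1 {V : Type*} [Fintype V] (G : SimpleGraph V) (hG : G.Connected)
    {n : ℕ} (hcard : Fintype.card V = n) (hn : 1 ≤ n)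
    (c : Nat.Partition n → ℤ)
    (hc : chromSym G = ∑ lam : Nat.Partition n, c lam • (lam.parts.map powerSum).prod)
    (P : Polynomial ℤ)
    (hP : ∀ q : ℕ, P.eval (q : ℤ) =
      Nat.card {κ : V → Fin q // ∀ u v, G.Adj u v → κ u ≠ κ v})
    (lamn : Nat.Partition n) (hlamn : lamn.parts = {n}) :
    |c lamn| = |P.coeff 1| := by
  have hPeq : P = ∑ lam : Nat.Partition n,
      Polynomial.C (c lam) * Polynomial.X ^ lam.parts.card := by
    refine Polynomial.eq_of_infinite_eval_eq _ _ ?_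
    refine (Set.infinite_range_of_injective (Nat.cast_injective (R := ℤ))).mono ?_
    rintro _ ⟨q, rfl⟩
    simp only [Set.mem_ofPred_eq]
    rw [hP, ← spec_chromSym, ← coeff_spec, hc, hcard, Polynomial.eval_finsetSum,
      ← MvPowerSeries.substAlgHom_apply (specVar_hasSubst q), map_sum, map_sum]
    refine Finset.sum_congr rfl fun lam _ => ?_
    rw [map_zsmul, map_zsmul, MvPowerSeries.substAlgHom_apply,
      spec_prod q _ fun i hi => lam.parts_pos hi, lam.parts_sum, MvPowerSeries.coeff_monomial]
    simp
  have hcoef : P.coeff 1 = c lamn := by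
    rw [hPeq, Polynomial.finsetSum_coeff, Finset.sum_eq_single lamn]
    · simp [hlamn, Polynomial.coeff_X]
    · intro lam _ hne
      rw [Polynomial.coeff_C_mul, Polynomial.coeff_X_pow, if_neg, mul_zero]
      intro h
      apply hne
      obtain ⟨a, ha⟩ := Multiset.card_eq_one.1 h.symm
      have hs := lam.parts_sum
      rw [ha, Multiset.sum_singleton] at hs
      apply Nat.Partition.ext
      rw [ha, hlamn, hs]
    · simp
  rw [hcoef]
end

section
/- Let G be a connected simple graph on a finite vertex type V with n = |V| ≥ 1, let μ : L_G → ℤ be the Möbius function of the bond lattice L_G of G, let ⊤ ∈ L_G denote the partition of V with the single block V (which lies in L_G since G is connected), and let P ∈ ℤ[q] be the chromatic polynomial of G, i.e. for every natural number q, P evaluated at q equals the number of proper colorings κ : V → Fin q of G. Then |μ(⊤)| = |P.coeff 1|, i.e. the absolute value of the Möbius function of the bond lattice at its top element equals the chromatic discriminant of G. -/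
open scoped Classical

namespace Stmt2Aux

variable {V : Type*} [Fintype V] [DecidableEq V]

/-- The spanning subgraph of monochromatic edges. -/
def mono (G : SimpleGraph V) {q : ℕ} (κ : V → Fin q) : SimpleGraph V where
  Adj u v := G.Adj u v ∧ κ u = κ v
  symm := ⟨fun _ _ h => ⟨h.1.symm, h.2.symm⟩⟩
  loopless := ⟨fun _ h => G.irrefl h.1⟩

/-- The partition into monochromatic connected components. -/
noncomputable def cpart (G : SimpleGraph V) {q : ℕ} (κ : V → Fin q) :
    Finpartition (Finset.univ : Finset V) :=
  Finpartition.ofSetoid (mono G κ).reachableSetoid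

lemma mem_cpart (G : SimpleGraph V) {q : ℕ} (κ : V → Fin q) (a b : V) :
    b ∈ (cpart G κ).part a ↔ (mono G κ).Reachable a b :=
  Finpartition.mem_part_ofSetoid_iff_rel

lemma color_eq (G : SimpleGraph V) {q : ℕ} (κ : V → Fin q) {a b : V}
    (h : (mono G κ).Reachable a b) : κ a = κ b := by
  obtain ⟨w⟩ := h
  induction w with
  | nil => rfl
  | cons h _ ih => exact h.2.trans ih

lemma le_iff_part (σ π : Finpartition (Finset.univ : Finset V)) :
    σ ≤ π ↔ ∀ u, σ.part u ⊆ π.part u := by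
  constructor
  · intro h u
    obtain ⟨c, hc, hle⟩ := h (σ.part_mem.2 (Finset.mem_univ u))
    have : u ∈ c := hle (σ.mem_part (Finset.mem_univ u))
    rw [π.part_eq_of_mem hc this]
    exact hle
  · intro h B hB
    obtain ⟨u, hu⟩ := σ.nonempty_of_mem_parts hB
    refine ⟨π.part u, π.part_mem.2 (Finset.mem_univ u), ?_⟩
    have := h u
    rwa [σ.part_eq_of_mem hB hu] at this

lemma cpart_conn (G : SimpleGraph V) {q : ℕ} (κ : V → Fin q) :
    ∀ B ∈ (cpart G κ).parts, (G.induce (B : Set V)).Connected := by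
  intro B hB
  obtain ⟨u, hu⟩ := (cpart G κ).nonempty_of_mem_parts hB
  have h1 := (cpart G κ).part_eq_of_mem hB hu
  have h2 : (B : Set V) = ((mono G κ).connectedComponentMk u).supp := by
    ext v
    rw [← h1, Finset.mem_coe, mem_cpart, SimpleGraph.ConnectedComponent.mem_supp_iff,
      SimpleGraph.ConnectedComponent.eq]
    exact SimpleGraph.reachable_comm
  rw [h2]
  refine ((mono G κ).connectedComponentMk u).connected_toSimpleGraph.mono ?_
  intro a b h
  exact h.1

lemma le_cpart_iff (G : SimpleGraph V) {q : ℕ} (κ : V → Fin q)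
    (σ : Finpartition (Finset.univ : Finset V))
    (hσ : ∀ B ∈ σ.parts, (G.induce (B : Set V)).Connected) :
    σ ≤ cpart G κ ↔ ∀ u v, v ∈ σ.part u → κ u = κ v := by
  rw [le_iff_part]
  constructor
  · intro h u v hv
    exact color_eq G κ ((mem_cpart G κ u v).1 (h u hv))
  · intro h u v hv
    rw [mem_cpart]
    have hB := σ.part_mem.2 (Finset.mem_univ u)
    have hr := (hσ _ hB).preconnected ⟨u, σ.mem_part (Finset.mem_univ u)⟩ ⟨v, hv⟩
    let f : G.induce ((σ.part u : Finset V) : Set V) →g mono G κ :=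
      { toFun := fun x => x.1
        map_rel' := fun {a b} hab =>
          ⟨hab, (h u a.1 a.2).symm.trans (h u b.1 b.2)⟩ }
    exact hr.map f

lemma cpart_eq_bot_iff (G : SimpleGraph V) {q : ℕ} (κ : V → Fin q) :
    cpart G κ = ⊥ ↔ ∀ u v, G.Adj u v → κ u ≠ κ v := by
  have hb : ∀ u : V, (⊥ : Finpartition (Finset.univ : Finset V)).part u = {u} := fun u =>
    Finpartition.part_eq_of_mem _ (Finpartition.mem_bot_iff.2 ⟨u, Finset.mem_univ u, rfl⟩)
      (Finset.mem_singleton_self u)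
  rw [← le_bot_iff, le_iff_part]
  simp only [hb]
  constructor
  · intro h u v huv hc
    have hadj : (mono G κ).Adj u v := ⟨huv, hc⟩
    have := h u ((mem_cpart G κ u v).2 hadj.reachable)
    rw [Finset.mem_singleton] at this
    exact G.ne_of_adj huv this.symm
  · intro h u v hv
    rw [mem_cpart] at hv
    obtain ⟨w⟩ := hv
    cases w with
    | nil => simp
    | cons h' _ => exact absurd h'.2 (h _ _ h'.1)

lemma card_const (σ : Finpartition (Finset.univ : Finset V)) (q : ℕ) :
    Fintype.card {κ : V → Fin q // ∀ u v, v ∈ σ.part u → κ u = κ v} = q ^ σ.parts.card := by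
  have e : {κ : V → Fin q // ∀ u v, v ∈ σ.part u → κ u = κ v} ≃ (σ.parts → Fin q) :=
    { toFun := fun κ B => κ.1 (σ.nonempty_of_mem_parts B.2).choose
      invFun := fun f => ⟨fun u => f ⟨σ.part u, σ.part_mem.2 (Finset.mem_univ u)⟩, by
        intro u v hv
        have := σ.part_eq_of_mem (σ.part_mem.2 (Finset.mem_univ u)) hv
        simp only [this]⟩
      left_inv := by
        intro κ
        ext1
        funext u
        exact (κ.2 _ _ (σ.nonempty_of_mem_parts (σ.part_mem.2 (Finset.mem_univ u))).choose_spec).symm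
      right_inv := by
        intro f
        funext B
        have := σ.part_eq_of_mem B.2 (σ.nonempty_of_mem_parts B.2).choose_spec
        simp only [this] }
  rw [Fintype.card_congr e]
  simp

end Stmt2Aux


/-- The absolute value of the Möbius function of the bond lattice of a connected graph `G`
at the top element (the one-block partition) equals the chromatic discriminant of `G`. -/
theorem stmt2 {V : Type*} [Fintype V] [DecidableEq V] (G : SimpleGraph V)
    (hG : G.Connected) (hn : 1 ≤ Fintype.card V)
    (L : Finset (Finpartition (Finset.univ : Finset V)))
    (hL : ∀ π : Finpartition (Finset.univ : Finset V),
      π ∈ L ↔ ∀ B ∈ π.parts, (G.induce (B : Set V)).Connected)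
    (μ : Finpartition (Finset.univ : Finset V) → ℤ)
    (hμ : ∀ π ∈ L, (∑ σ ∈ L.filter fun σ => σ ≤ π, μ σ) = if π = ⊥ then 1 else 0)
    (πtop : Finpartition (Finset.univ : Finset V))
    (htop : πtop.parts = {Finset.univ})
    (P : Polynomial ℤ)
    (hP : ∀ q : ℕ, P.eval (q : ℤ) =
      Nat.card {κ : V → Fin q // ∀ u v, G.Adj u v → κ u ≠ κ v}) :
    |μ πtop| = |P.coeff 1| := by
  have key : P = ∑ σ ∈ L, Polynomial.C (μ σ) * Polynomial.X ^ σ.parts.card := by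
    apply Polynomial.eq_of_infinite_eval_eq
    refine (Set.infinite_range_of_injective (Nat.cast_injective (R := ℤ))).mono ?_
    rintro _ ⟨q, rfl⟩
    simp only [Set.mem_setOf_eq]
    rw [hP, Polynomial.eval_finsetSum]
    have h1 : ∀ κ : V → Fin q,
        (∑ σ ∈ L, if σ ≤ Stmt2Aux.cpart G κ then μ σ else 0) =
          if (∀ u v, G.Adj u v → κ u ≠ κ v) then 1 else 0 := by
      intro κ
      rw [← Finset.sum_filter]
      have := hμ (Stmt2Aux.cpart G κ) ((hL _).2 (Stmt2Aux.cpart_conn G κ))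
      simp only [Stmt2Aux.cpart_eq_bot_iff] at this
      convert this
    have h2 : (Nat.card {κ : V → Fin q // ∀ u v, G.Adj u v → κ u ≠ κ v} : ℤ) =
        ∑ κ : V → Fin q, if (∀ u v, G.Adj u v → κ u ≠ κ v) then 1 else 0 := by
      rw [Nat.card_eq_fintype_card, Fintype.card_subtype, Finset.sum_boole]
    rw [h2, ← Finset.sum_congr rfl (fun κ _ => h1 κ), Finset.sum_comm]
    refine Finset.sum_congr rfl fun σ hσ => ?_
    simp only [Stmt2Aux.le_cpart_iff G _ σ ((hL σ).1 hσ)]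
    rw [← Finset.sum_filter, Finset.sum_const, ← Fintype.card_subtype, Stmt2Aux.card_const]
    simp [mul_comm]
  have htopL : πtop ∈ L := by
    rw [hL]
    intro B hB
    rw [htop, Finset.mem_singleton] at hB
    subst hB
    rw [Finset.coe_univ]
    exact (SimpleGraph.induceUnivIso G).connected_iff.2 hG
  have hc : P.coeff 1 = μ πtop := by
    rw [key, Polynomial.finsetSum_coeff, Finset.sum_eq_single πtop]
    · simp [htop]
    · intro σ _ hne
      rw [Polynomial.coeff_C_mul, Polynomial.coeff_X_pow, if_neg, mul_zero]
      intro h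
      apply hne
      obtain ⟨B, hB⟩ := Finset.card_eq_one.1 h.symm
      have hs := σ.sup_parts
      rw [hB, Finset.sup_singleton] at hs
      ext1
      rw [hB, htop]
      simp only [id] at hs
      rw [hs]
    · intro h
      exact absurd htopL h
  rw [hc]
end

section
/- Let G₁ and G₂ be connected simple graphs on finite vertex types V₁ and V₂ with |V₁| = |V₂| = n ≥ 1, and let P₁, P₂ ∈ ℤ[q] be their chromatic polynomials, i.e. for every natural number q, Pᵢ evaluated at q equals the number of proper colorings of Gᵢ with color set Fin q. If |P₁.coeff 1| ≠ |P₂.coeff 1| (the graphs have different chromatic discriminants), then X_{G₁} ≠ X_{G₂} as elements of MvPowerSeries ℕ ℤ; that is, graphs with different chromatic discriminants are distinguished by their chromatic symmetric functions. -/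
open scoped Classical

/-- Proper colorings with prescribed color class sizes. -/
abbrev Fib {V : Type*} (G : SimpleGraph V) (d : ℕ →₀ ℕ) : Type _ :=
  {κ : V → ℕ // (∀ u v, G.Adj u v → κ u ≠ κ v) ∧
      ∀ i : ℕ, Nat.card {v : V // κ v = i} = d i}

theorem Fib.mem_support {V : Type*} [Fintype V] {G : SimpleGraph V} {d : ℕ →₀ ℕ}
    (x : Fib G d) (v : V) : x.1 v ∈ d.support := by
  rw [Finsupp.mem_support_iff, ← x.2.2]
  have : Nonempty {w : V // x.1 w = x.1 v} := ⟨⟨v, rfl⟩⟩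
  exact Nat.card_pos.ne'

instance Fib.instFinite {V : Type*} [Fintype V] (G : SimpleGraph V) (d : ℕ →₀ ℕ) :
    Finite (Fib G d) := by
  refine Finite.of_injective
    (fun (x : Fib G d) (v : V) => (⟨x.1 v, x.mem_support v⟩ : {i // i ∈ d.support})) ?_
  intro x y h
  apply Subtype.ext
  funext v
  exact congrArg Subtype.val (congrFun h v)

/-- The type of a coloring. -/
noncomputable def colType {V : Type*} [Fintype V] (κ : V → ℕ) : ℕ →₀ ℕ :=
  Finsupp.ofSupportFinite (fun i => Nat.card {v : V // κ v = i}) (by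
    refine (Set.finite_range κ).subset ?_
    intro i hi
    by_contra hn
    apply hi
    have : IsEmpty {v : V // κ v = i} := ⟨fun w => hn ⟨w.1, w.2⟩⟩
    exact Nat.card_of_isEmpty)

theorem card_le_of_chromSym_eq {V₁ V₂ : Type*} [Fintype V₁] [Fintype V₂]
    (G₁ : SimpleGraph V₁) (G₂ : SimpleGraph V₂) (h : chromSym G₁ = chromSym G₂) (q : ℕ) :
    Nat.card {κ : V₁ → Fin q // ∀ u v, G₁.Adj u v → κ u ≠ κ v} ≤
      Nat.card {κ : V₂ → Fin q // ∀ u v, G₂.Adj u v → κ u ≠ κ v} := by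
  have hc : ∀ d, Nat.card (Fib G₁ d) = Nat.card (Fib G₂ d) := by
    intro d
    have := congrFun h d
    simp only [chromSym] at this
    exact_mod_cast this
  have he : ∀ d, Nonempty (Fib G₁ d ≃ Fib G₂ d) := fun d => Finite.card_eq.1 (hc d)
  let e : ∀ d, Fib G₁ d ≃ Fib G₂ d := fun d => Classical.choice (he d)
  have key : ∀ d d' (x : Fib G₁ d) (y : Fib G₁ d'), (e d x).1 = (e d' y).1 → x.1 = y.1 := by
    intro d d' x y hxy
    have hd : d = d' := by
      ext i
      rw [← (e d x).2.2 i, ← (e d' y).2.2 i, hxy]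
    subst hd
    rw [(e d).injective (Subtype.ext hxy)]
  let φ : {κ : V₁ → Fin q // ∀ u v, G₁.Adj u v → κ u ≠ κ v} →
      Σ d, Fib G₁ d := fun κ => ⟨colType (fun v => (κ.1 v : ℕ)), fun v => (κ.1 v : ℕ),
        fun u v huv hE => κ.2 u v huv (Fin.ext hE), fun i => rfl⟩
  have hlt : ∀ κ v, (e (φ κ).1 (φ κ).2).1 v < q := by
    intro κ v
    have hm := (e (φ κ).1 (φ κ).2).mem_support v
    rw [Finsupp.mem_support_iff, ← (φ κ).2.2.2] at hm
    obtain ⟨w, hw⟩ := (Nat.card_ne_zero.1 hm).1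
    rw [← hw]
    exact (κ.1 w).2
  refine Nat.card_le_card_of_injective
    (fun κ => ⟨fun v => ⟨(e (φ κ).1 (φ κ).2).1 v, hlt κ v⟩,
      fun u v huv hE => (e (φ κ).1 (φ κ).2).2.1 u v huv (congrArg Fin.val hE)⟩) ?_
  intro κ κ' hE
  have h1 := key _ _ (φ κ).2 (φ κ').2 (by
    funext v
    exact congrArg Fin.val (congrFun (congrArg Subtype.val hE) v))
  apply Subtype.ext
  funext v
  exact Fin.ext (congrFun h1 v)

/-- Connected graphs of the same order with different chromatic discriminants are
distinguished by their chromatic symmetric functions. -/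
theorem stmt3 {V₁ V₂ : Type*} [Fintype V₁] [Fintype V₂]
    (G₁ : SimpleGraph V₁) (G₂ : SimpleGraph V₂)
    (h₁ : G₁.Connected) (h₂ : G₂.Connected)
    {n : ℕ} (hn₁ : Fintype.card V₁ = n) (hn₂ : Fintype.card V₂ = n) (hn : 1 ≤ n)
    (P₁ P₂ : Polynomial ℤ)
    (hP₁ : ∀ q : ℕ, P₁.eval (q : ℤ) =
      Nat.card {κ : V₁ → Fin q // ∀ u v, G₁.Adj u v → κ u ≠ κ v})
    (hP₂ : ∀ q : ℕ, P₂.eval (q : ℤ) =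
      Nat.card {κ : V₂ → Fin q // ∀ u v, G₂.Adj u v → κ u ≠ κ v})
    (hdisc : |P₁.coeff 1| ≠ |P₂.coeff 1|) :
    chromSym G₁ ≠ chromSym G₂ := by
  intro h
  apply hdisc
  have : P₁ = P₂ := by
    refine Polynomial.eq_of_infinite_eval_eq P₁ P₂
      ((Set.infinite_range_of_injective (Nat.cast_injective (R := ℤ))).mono ?_)
    rintro _ ⟨q, rfl⟩
    simp only [Set.mem_setOf_eq]
    rw [hP₁, hP₂, le_antisymm (card_le_of_chromSym_eq G₁ G₂ h q)
      (card_le_of_chromSym_eq G₂ G₁ h.symm q)]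
  rw [this]
end

section
/- Let G be a simple graph on a finite vertex type V, and let p : ℕ → MvPolynomial V ℚ be a sequence of polynomials satisfying Newton's relation n • e_n^G = Σ_{i=1}^{n} (-1)^(i-1) · p_i · e_{n-i}^G for every n ≥ 1 (such a sequence exists and its values p_n for n ≥ 1 are uniquely determined; these are the G-power sum symmetric functions p_n^G). Then for every partition λ = (λ_1, …, λ_k), every coefficient of the polynomial p_λ^G := p_{λ_1} ⋯ p_{λ_k} ∈ MvPolynomial V ℚ is a nonnegative integer. -/
open scoped Classical

/-- The `G`-elementary symmetric function `e_n^G`: the sum over all independent (stable)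
sets `S` of `G` with `|S| = n` of the monomials `∏_{v ∈ S} x_v`. -/
noncomputable def elemG {V : Type*} [Fintype V] (G : SimpleGraph V) (n : ℕ) :
    MvPolynomial V ℚ :=
  ∑ S ∈ Finset.univ.filter
      (fun S : Finset V => (∀ u ∈ S, ∀ v ∈ S, ¬ G.Adj u v) ∧ S.card = n),
    ∏ v ∈ S, MvPolynomial.X v

/-- polynomials with natural-number coefficients -/
noncomputable def natPol (V : Type*) : Subsemiring (MvPolynomial V ℚ) :=
  (MvPolynomial.map (σ := V) (Nat.castRingHom ℚ)).rangeS

theorem X_mem_natPol {V : Type*} (v : V) : MvPolynomial.X v ∈ natPol V :=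
  ⟨MvPolynomial.X v, by simp⟩

/-- signed monomial of a set -/
noncomputable def monG {V : Type*} (S : Finset V) : PowerSeries (MvPolynomial V ℚ) :=
  ∏ v ∈ S, (-(PowerSeries.C (MvPolynomial.X v) * PowerSeries.X))

/-- independent subsets of `A` -/
noncomputable def indG {V : Type*} (G : SimpleGraph V) (A : Finset V) : Finset (Finset V) :=
  A.powerset.filter (fun S => ∀ u ∈ S, ∀ v ∈ S, ¬ G.Adj u v)

/-- signed independence series -/
noncomputable def serG {V : Type*} (G : SimpleGraph V) (A : Finset V) :
    PowerSeries (MvPolynomial V ℚ) := ∑ S ∈ indG G A, monG S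

/-- `A` minus the closed neighbourhood of `v` -/
noncomputable def delG {V : Type*} (G : SimpleGraph V) (A : Finset V) (v : V) : Finset V :=
  A.filter (fun u => u ≠ v ∧ ¬ G.Adj v u)

theorem monG_eq {V : Type*} (S : Finset V) :
    monG S = PowerSeries.C ((-1) ^ S.card * ∏ v ∈ S, MvPolynomial.X v) *
      PowerSeries.X ^ S.card := by
  unfold monG
  rw [Finset.prod_neg, Finset.prod_mul_distrib]
  simp [mul_assoc]

theorem coeff_monG {V : Type*} (S : Finset V) (n : ℕ) :
    PowerSeries.coeff n (monG S) =
      if S.card = n then (-1) ^ n * ∏ v ∈ S, MvPolynomial.X v else 0 := by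
  rw [monG_eq, PowerSeries.coeff_C_mul, PowerSeries.coeff_X_pow]
  by_cases h : S.card = n
  · subst h; simp
  · rw [if_neg h, if_neg (fun h' => h h'.symm), mul_zero]

theorem sum_memG {V : Type*} (G : SimpleGraph V) (A : Finset V) (v : V) (hv : v ∈ A) :
    ∑ S ∈ (indG G A).filter (fun S => v ∈ S), monG S =
      -(PowerSeries.C (MvPolynomial.X v) * PowerSeries.X) * serG G (delG G A v) := by
  unfold serG
  rw [Finset.mul_sum]
  refine Finset.sum_bij' (fun S _ => S.erase v) (fun S _ => insert v S) ?_ ?_ ?_ ?_ ?_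
  · intro S hS
    simp only [indG, delG, Finset.mem_filter, Finset.mem_powerset] at hS ⊢
    obtain ⟨⟨h1, h2⟩, h3⟩ := hS
    refine ⟨?_, ?_⟩
    · intro u hu
      rw [Finset.mem_erase] at hu
      simp only [Finset.mem_filter]
      exact ⟨h1 hu.2, hu.1, h2 v h3 u hu.2⟩
    · intro a ha b hb
      exact h2 a (Finset.mem_of_mem_erase ha) b (Finset.mem_of_mem_erase hb)
  · intro S hS
    simp only [indG, delG, Finset.mem_filter, Finset.mem_powerset] at hS ⊢
    obtain ⟨h1, h2⟩ := hS
    have h1' : ∀ u ∈ S, u ∈ A ∧ u ≠ v ∧ ¬ G.Adj v u := fun u hu => by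
      simpa using h1 hu
    refine ⟨⟨?_, ?_⟩, Finset.mem_insert_self _ _⟩
    · intro u hu
      rcases Finset.mem_insert.1 hu with rfl | hu
      · exact hv
      · exact (h1' u hu).1
    · intro a ha b hb
      rcases Finset.mem_insert.1 ha with rfl | ha2 <;> rcases Finset.mem_insert.1 hb with rfl | hb2
      · exact G.irrefl
      · exact (h1' b hb2).2.2
      · exact fun h => (h1' a ha2).2.2 h.symm
      · exact h2 a ha2 b hb2
  · intro S hS
    exact Finset.insert_erase (Finset.mem_filter.1 hS).2
  · intro S hS
    refine Finset.erase_insert ?_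
    intro h
    simp only [indG, delG, Finset.mem_filter, Finset.mem_powerset] at hS
    have := hS.1 h
    simp at this
  · intro S hS
    exact (Finset.mul_prod_erase S _ (Finset.mem_filter.1 hS).2).symm

theorem serG_del {V : Type*} (G : SimpleGraph V) (A : Finset V) (v : V) (hv : v ∈ A) :
    serG G A = serG G (A.erase v) -
      PowerSeries.C (MvPolynomial.X v) * PowerSeries.X * serG G (delG G A v) := by
  have h := sum_memG G A v hv
  have h2 : ∑ S ∈ (indG G A).filter (fun S => ¬ v ∈ S), monG S = serG G (A.erase v) := by
    unfold serG
    congr 1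
    ext S
    simp only [indG, Finset.mem_filter, Finset.mem_powerset, Finset.subset_erase]
    tauto
  have h3 := Finset.sum_filter_add_sum_filter_not (indG G A) (fun S => v ∈ S) monG
  rw [h, h2] at h3
  rw [serG, ← h3]; ring

theorem geom_nat {V : Type*} (y : MvPolynomial V ℚ) (hy : y ∈ natPol V)
    (Q : PowerSeries (MvPolynomial V ℚ)) (hQ : ∀ n, PowerSeries.coeff n Q ∈ natPol V) :
    ∃ U : PowerSeries (MvPolynomial V ℚ), (∀ n, PowerSeries.coeff n U ∈ natPol V) ∧
      U * (1 - PowerSeries.C y * PowerSeries.X * Q) = 1 := by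
  set F := 1 - PowerSeries.C y * PowerSeries.X * Q with hF
  have hu : F * PowerSeries.invOfUnit F 1 = 1 := by
    apply PowerSeries.mul_invOfUnit
    simp [hF]
  set U := PowerSeries.invOfUnit F 1
  refine ⟨U, ?_, by rw [mul_comm]; exact hu⟩
  have hU : U = 1 + PowerSeries.X * (PowerSeries.C y * (Q * U)) := by
    rw [hF] at hu
    linear_combination hu
  intro n
  induction n using Nat.strong_induction_on with
  | _ n ih =>
    rw [hU]
    rcases n with _ | n
    · simp [one_mem]
    · rw [map_add, PowerSeries.coeff_succ_X_mul, PowerSeries.coeff_C_mul, PowerSeries.coeff_mul,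
        PowerSeries.coeff_one, if_neg (Nat.succ_ne_zero n), zero_add]
      refine mul_mem hy (_root_.sum_mem fun x hx => mul_mem (hQ _) (ih _ ?_))
      have := Finset.HasAntidiagonal.mem_antidiagonal.1 hx
      omega

theorem ratio_nat {V : Type*} (G : SimpleGraph V) (k : ℕ) : ∀ (A B : Finset V), B.card = k →
    A ⊆ B → ∃ Q : PowerSeries (MvPolynomial V ℚ), (∀ n, PowerSeries.coeff n Q ∈ natPol V) ∧
      serG G A = Q * serG G B := by
  induction k with
  | zero =>
    intro A B hB hAB
    rw [Finset.card_eq_zero] at hB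
    subst hB
    rw [Finset.subset_empty] at hAB
    subst hAB
    refine ⟨1, fun n => ?_, by simp⟩
    rw [PowerSeries.coeff_one]
    split_ifs
    exacts [one_mem _, zero_mem _]
  | succ k ih =>
    intro A B hB hAB
    by_cases h : A = B
    · subst h
      refine ⟨1, fun n => ?_, by simp⟩
      rw [PowerSeries.coeff_one]
      split_ifs
      exacts [one_mem _, zero_mem _]
    · obtain ⟨v, hvB, hvA⟩ := Finset.exists_of_ssubset (hAB.ssubset_of_ne h)
      have hc : (B.erase v).card = k := by rw [Finset.card_erase_of_mem hvB]; omega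
      obtain ⟨Q1, h1, e1⟩ := ih A (B.erase v) hc (Finset.subset_erase.2 ⟨hAB, hvA⟩)
      obtain ⟨Q2, h2, e2⟩ := ih (delG G B v) (B.erase v) hc (by
        intro u hu
        simp only [delG, Finset.mem_filter] at hu
        exact Finset.mem_erase.2 ⟨hu.2.1, hu.1⟩)
      obtain ⟨U, h3, e3⟩ := geom_nat _ (X_mem_natPol v) Q2 h2
      refine ⟨Q1 * U, fun n => ?_, ?_⟩
      · rw [PowerSeries.coeff_mul]
        exact _root_.sum_mem fun x _ => mul_mem (h1 _) (h3 _)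
      · have e4 := serG_del G B v hvB
        rw [e2] at e4
        rw [e1, e4]
        linear_combination (-Q1 * serG G (B.erase v)) * e3

theorem coeff_serG {V : Type*} [Fintype V] (G : SimpleGraph V) (n : ℕ) :
    PowerSeries.coeff n (serG G Finset.univ) = (-1) ^ n * elemG G n := by
  unfold serG elemG
  simp only [map_sum, coeff_monG]
  rw [← Finset.sum_filter, Finset.mul_sum]
  congr 1
  ext S
  simp [indG]

theorem coeff_card {V : Type*} [Fintype V] (G : SimpleGraph V) (n : ℕ) :
    PowerSeries.coeff n (∑ S ∈ indG G Finset.univ, S.card • monG S) =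
      (-1) ^ n * (n • elemG G n) := by
  rw [mul_smul_comm, ← coeff_serG]
  unfold serG
  simp only [map_sum, map_nsmul, coeff_monG, Finset.smul_sum]
  refine Finset.sum_congr rfl fun S _ => ?_
  split_ifs with h
  · rw [h]
  · simp

theorem card_sum {V : Type*} [Fintype V] (G : SimpleGraph V) :
    (∑ S ∈ indG G Finset.univ, S.card • monG S) =
      ∑ v : V, -(PowerSeries.C (MvPolynomial.X v) * PowerSeries.X) *
        serG G (delG G Finset.univ v) := by
  simp only [← sum_memG G Finset.univ _ (Finset.mem_univ _), Finset.sum_filter]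
  rw [Finset.sum_comm]
  refine Finset.sum_congr rfl fun S _ => ?_
  rw [← Finset.sum_filter]
  simp

theorem p_nat {V : Type*} [Fintype V] (G : SimpleGraph V)
    (p : ℕ → MvPolynomial V ℚ)
    (hp : ∀ n : ℕ, 1 ≤ n → n • elemG G n =
      ∑ i ∈ Finset.Icc 1 n, (-1 : MvPolynomial V ℚ) ^ (i - 1) * p i * elemG G (n - i))
    (n : ℕ) (hn : 1 ≤ n) : p n ∈ natPol V := by
  have hQ : ∀ v : V, ∃ Q : PowerSeries (MvPolynomial V ℚ),
      (∀ n, PowerSeries.coeff n Q ∈ natPol V) ∧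
      serG G (delG G Finset.univ v) = Q * serG G Finset.univ :=
    fun v => ratio_nat G _ _ _ rfl (Finset.subset_univ _)
  choose Q hQ1 hQ2 using hQ
  let P : PowerSeries (MvPolynomial V ℚ) := PowerSeries.mk fun n => if n = 0 then 0 else p n
  have key : -P * serG G Finset.univ = ∑ S ∈ indG G Finset.univ, S.card • monG S := by
    ext1 n
    rw [coeff_card, neg_mul, map_neg, PowerSeries.coeff_mul,
      Finset.Nat.sum_antidiagonal_eq_sum_range_succ_mk, Finset.sum_range_succ']
    rcases Nat.eq_zero_or_pos n with rfl | hn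
    · simp [P]
    · rw [hp n hn, Finset.mul_sum, Finset.range_eq_Ico,
        Finset.sum_Ico_add' (fun i => PowerSeries.coeff i P *
          PowerSeries.coeff (n - i) (serG G Finset.univ)) 0 n 1]
      have : Finset.Ico (0 + 1) (n + 1) = Finset.Icc 1 n := by
        ext; simp
      rw [this]
      simp only [P, PowerSeries.coeff_mk, if_true, zero_mul, add_zero]
      rw [← Finset.sum_neg_distrib]
      refine Finset.sum_congr rfl fun i hi => ?_
      rw [Finset.mem_Icc] at hi
      rw [if_neg (by omega), coeff_serG]
      obtain ⟨j, rfl⟩ : ∃ j, i = j + 1 := ⟨i - 1, by omega⟩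
      obtain ⟨k, rfl⟩ : ∃ k, n = j + 1 + k := ⟨n - (j + 1), by omega⟩
      have hs : ((-1 : MvPolynomial V ℚ) ^ j) * (-1) ^ j = 1 := by
        rw [← mul_pow]; simp
      simp only [Nat.add_sub_cancel_left, Nat.add_sub_cancel]
      rw [pow_add, pow_succ]
      linear_combination (-(-1 : MvPolynomial V ℚ) ^ k * p (j+1) * elemG G k) * (-hs)
  have hne : serG G Finset.univ ≠ 0 := by
    intro h
    have := coeff_serG G 0
    rw [h] at this
    have h0 : elemG G 0 = 1 := by
      unfold elemG
      rw [Finset.sum_eq_single ∅]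
      · simp
      · intro S hS hS'
        simp at hS
        exact absurd hS.2 hS'
      · simp
    rw [h0] at this
    simp at this
  have hP : P = ∑ v : V, PowerSeries.C (MvPolynomial.X v) * (PowerSeries.X * Q v) := by
    apply mul_right_cancel₀ hne
    rw [card_sum] at key
    rw [← neg_inj, ← neg_mul, key, Finset.sum_mul, ← Finset.sum_neg_distrib]
    refine Finset.sum_congr rfl fun v _ => ?_
    rw [hQ2]; ring
  have : p n = PowerSeries.coeff n P := by
    simp only [P, PowerSeries.coeff_mk]
    rw [if_neg (by omega)]
  rw [this, hP, map_sum]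
  refine _root_.sum_mem fun v _ => ?_
  obtain ⟨j, rfl⟩ : ∃ j, n = j + 1 := ⟨n - 1, by omega⟩
  rw [PowerSeries.coeff_C_mul, PowerSeries.coeff_succ_X_mul]
  exact mul_mem (X_mem_natPol v) (hQ1 _ _)

/-- The `G`-power sum symmetric functions, defined from the `G`-elementary symmetric
functions by Newton's relation, have nonnegative integral coefficients: for any partition
`λ`, every coefficient of `p_λ^G = p_{λ₁}^G ⋯ p_{λ_k}^G` is a nonnegative integer. -/
theorem stmt4 {V : Type*} [Fintype V] (G : SimpleGraph V)
    (p : ℕ → MvPolynomial V ℚ)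
    (hp : ∀ n : ℕ, 1 ≤ n → n • elemG G n =
      ∑ i ∈ Finset.Icc 1 n, (-1 : MvPolynomial V ℚ) ^ (i - 1) * p i * elemG G (n - i)) :
    ∀ {m : ℕ} (lam : Nat.Partition m) (d : V →₀ ℕ),
      ∃ c : ℕ, MvPolynomial.coeff d ((lam.parts.map p).prod) = (c : ℚ) := by
  intro m lam d
  have h : (lam.parts.map p).prod ∈ natPol V := by
    refine multiset_prod_mem _ fun x hx => ?_
    obtain ⟨i, hi, rfl⟩ := Multiset.mem_map.1 hx
    exact p_nat G p hp i (lam.parts_pos hi)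
  obtain ⟨q, hq⟩ := h
  refine ⟨MvPolynomial.coeff d q, ?_⟩
  rw [← hq, MvPolynomial.coeff_map]
  rfl
end

section
/- Let G be a simple graph on a finite vertex type V, let k : V → ℕ, and let d : ℕ → ℕ be finitely supported. Then the coefficient of the monomial ∏_i x_i^(d i) in the k-chromatic symmetric function X_k^G (i.e. the number of proper k-multicolorings τ : V → Finset ℕ of G such that |{v : i ∈ τ(v)}| = d i for every i) equals the coefficient of the monomial ∏_{v ∈ V} x_v^(k v) in the polynomial ∏_{i ∈ supp(d)} e_{d i}^G ∈ MvPolynomial V ℚ. -/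
open scoped Classical

/-- The coefficient of `∏ i, x_i ^ d i` in the `k`-chromatic symmetric function `X_k^G`
(the number of proper `k`-multicolorings `τ : V → Finset ℕ` with `|{v : i ∈ τ v}| = d i`
for all `i`) equals the coefficient of the monomial `∏ v, x_v ^ k v` in
`∏_{i ∈ supp d} e_{d i}^G`. -/
theorem stmt5 {V : Type*} [Fintype V] (G : SimpleGraph V) (k : V → ℕ) (d : ℕ →₀ ℕ) :
    (Nat.card {τ : V → Finset ℕ //
        (∀ v, (τ v).card = k v) ∧
        (∀ u v, G.Adj u v → τ u ∩ τ v = ∅) ∧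
        ∀ i : ℕ, (Finset.univ.filter fun v => i ∈ τ v).card = d i} : ℚ)
      = MvPolynomial.coeff (Finsupp.equivFunOnFinite.symm k)
          (∏ i ∈ d.support, elemG G (d i)) := by
  have hprod : (∏ i ∈ d.support, elemG G (d i)) =
      ∑ p ∈ Fintype.piFinset (fun i : d.support => Finset.univ.filter
        (fun S : Finset V => (∀ u ∈ S, ∀ v ∈ S, ¬ G.Adj u v) ∧ S.card = d i)),
        ∏ i : d.support, ∏ v ∈ p i, (MvPolynomial.X v : MvPolynomial V ℚ) := by
    rw [← Finset.prod_coe_sort]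
    simp only [elemG]
    rw [Finset.prod_univ_sum]
  have hmon : ∀ p : d.support → Finset V,
      (∏ i : d.support, ∏ v ∈ p i, (MvPolynomial.X v : MvPolynomial V ℚ)) =
      MvPolynomial.monomial (∑ i : d.support, ∑ v ∈ p i, Finsupp.single v 1) 1 := by
    intro p
    simp only [MvPolynomial.monomial_sum_one]
    rfl
  have hexp : ∀ p : d.support → Finset V,
      (∑ i : d.support, ∑ v ∈ p i, Finsupp.single v 1) = Finsupp.equivFunOnFinite.symm k ↔
      ∀ v, (Finset.univ.filter fun i : d.support => v ∈ p i).card = k v := by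
    intro p
    rw [Finsupp.ext_iff]
    refine forall_congr' fun v => ?_
    simp [Finsupp.finsetSum_apply, Finsupp.single_apply]
  rw [hprod, MvPolynomial.coeff_sum]
  simp only [hmon, MvPolynomial.coeff_monomial, hexp]
  rw [Finset.sum_boole, ← Nat.subtype_card _ (fun x => Iff.rfl), Nat.cast_inj]
  refine Nat.card_congr
    { toFun := fun τ => ⟨fun i => Finset.univ.filter fun v => (i : ℕ) ∈ τ.1 v, ?_⟩
      invFun := fun p => ⟨fun v => (Finset.univ.filter fun i : d.support => v ∈ p.1 i).map
        (Function.Embedding.subtype _), ?_⟩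
      left_inv := ?_
      right_inv := ?_ }
  · obtain ⟨τ, h1, h2, h3⟩ := τ
    have hs : ∀ v, ∀ i ∈ τ v, i ∈ d.support := by
      intro v i hi
      rw [Finsupp.mem_support_iff, ← h3 i]
      exact Finset.card_ne_zero_of_mem (a := v) (by simp [hi])
    simp only [Finset.mem_filter, Fintype.mem_piFinset, Finset.mem_univ, true_and]
    refine ⟨fun i => ⟨fun u hu v hv huv => ?_, h3 i⟩, fun v => ?_⟩
    · have : (i : ℕ) ∈ τ u ∩ τ v := Finset.mem_inter.2 ⟨hu, hv⟩
      rw [h2 u v huv] at this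
      simp at this
    · rw [← h1 v, ← Finset.card_map (Function.Embedding.subtype _)]
      congr 1
      ext i
      simp only [Finset.mem_map, Finset.mem_filter, Finset.mem_univ, true_and]
      constructor
      · rintro ⟨j, hj, rfl⟩
        exact hj
      · intro hi
        exact ⟨⟨i, hs v i hi⟩, hi, rfl⟩
  · obtain ⟨p, hp⟩ := p
    simp only [Finset.mem_filter, Fintype.mem_piFinset, Finset.mem_univ, true_and] at hp
    obtain ⟨hp, hk⟩ := hp
    refine ⟨fun v => by rw [Finset.card_map]; exact hk v, fun u v huv => ?_, fun i => ?_⟩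
    · rw [Finset.eq_empty_iff_forall_notMem]
      intro i hi
      simp only [Finset.mem_inter, Finset.mem_map, Finset.mem_filter, Finset.mem_univ,
        true_and] at hi
      obtain ⟨⟨a, ha, rfl⟩, ⟨b, hb, hab⟩⟩ := hi
      obtain rfl : b = a := Subtype.ext hab
      exact (hp b).1 u ha v hb huv
    · by_cases hi : i ∈ d.support
      · rw [← (hp ⟨i, hi⟩).2]
        congr 1
        ext v
        simp only [Finset.mem_map, Finset.mem_filter, Finset.mem_univ, true_and]
        constructor
        · rintro ⟨j, hj, rfl⟩
          exact hj
        · intro h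
          exact ⟨⟨i, hi⟩, h, rfl⟩
      · rw [Finsupp.notMem_support_iff.1 hi, Finset.card_eq_zero,
          Finset.filter_eq_empty_iff]
        intro v _ h
        simp only [Finset.mem_map, Finset.mem_filter, Finset.mem_univ, true_and] at h
        obtain ⟨j, hj, rfl⟩ := h
        exact hi j.2
  · rintro ⟨τ, h1, h2, h3⟩
    apply Subtype.ext
    funext v
    ext i
    simp only [Finset.mem_map, Finset.mem_filter, Finset.mem_univ, true_and]
    constructor
    · rintro ⟨j, hj, rfl⟩
      exact hj
    · intro hi
      refine ⟨⟨i, ?_⟩, hi, rfl⟩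
      rw [Finsupp.mem_support_iff, ← h3 i]
      exact Finset.card_ne_zero_of_mem (a := v) (by simp [hi])
  · rintro ⟨p, hp⟩
    apply Subtype.ext
    funext i
    ext v
    simp only [Finset.mem_map, Finset.mem_filter, Finset.mem_univ, true_and]
    constructor
    · rintro ⟨j, hj, hji⟩
      obtain rfl : j = i := Subtype.ext hji
      exact hj
    · intro h
      exact ⟨i, h, rfl⟩
end

section
/- Let G be a simple graph on a finite vertex type V and let k : V → ℕ. For each j ≥ 0, let N_j denote the number of ordered j-tuples (P_1, …, P_j) of nonempty independent subsets of V such that every vertex v belongs to exactly k v of the sets P_1, …, P_j. Then for every natural number q, the number π_k^G(q) of proper k-multicolorings of G with color set Fin q satisfies π_k^G(q) = Σ_{j ≥ 0} N_j · (q choose j), where the sum is finite since N_j = 0 for j > Σ_{v ∈ V} k v. -/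
open scoped Classical


theorem aux_zero {V : Type*} [Fintype V] (G : SimpleGraph V) (k : V → ℕ) (j : ℕ)
    (P : Fin j → Finset V)
    (h1 : ∀ a, (P a).Nonempty ∧ ∀ u ∈ P a, ∀ v ∈ P a, ¬ G.Adj u v)
    (h2 : ∀ v, (Finset.univ.filter fun a => v ∈ P a).card = k v) : j ≤ ∑ v, k v := by
  have h3 : ∑ v, k v = ∑ a, (P a).card := by
    simp_rw [← h2, Finset.card_eq_sum_ones, Finset.sum_filter]
    rw [Finset.sum_comm]
    refine Finset.sum_congr rfl fun a _ => ?_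
    simp
  rw [h3]
  calc j = ∑ a : Fin j, 1 := by simp
    _ ≤ _ := Finset.sum_le_sum fun a _ => (h1 a).1.card_pos

theorem aux_equiv {V : Type*} [Fintype V] (G : SimpleGraph V) (k : V → ℕ) (q : ℕ)
    (S : Finset (Fin q)) :
    Nat.card {τ : {τ : V → Finset (Fin q) //
          (∀ v, (τ v).card = k v) ∧ ∀ u v, G.Adj u v → τ u ∩ τ v = ∅} //
          Finset.univ.biUnion τ.1 = S} =
    Nat.card {P : Fin S.card → Finset V //
        (∀ a, (P a).Nonempty ∧ ∀ u ∈ P a, ∀ v ∈ P a, ¬ G.Adj u v) ∧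
        ∀ v, (Finset.univ.filter fun a => v ∈ P a).card = k v} := by
  let e : Fin S.card ≃ S := S.equivFin.symm
  let f : Fin S.card ↪ Fin q := e.toEmbedding.trans (Function.Embedding.subtype _)
  have hf : ∀ c, c ∈ S ↔ ∃ a, f a = c := by
    intro c
    constructor
    · intro h
      exact ⟨e.symm ⟨c, h⟩, by simp [f]⟩
    · rintro ⟨a, rfl⟩
      exact (e a).2
  have key : ∀ τ : V → Finset (Fin q), Finset.univ.biUnion τ = S → ∀ v,
      (Finset.univ.filter fun a => f a ∈ τ v).map f = τ v := by
    intro τ h v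
    ext c
    simp only [Finset.mem_map, Finset.mem_filter, Finset.mem_univ, true_and]
    constructor
    · rintro ⟨a, h, rfl⟩
      exact h
    · intro hc
      have : c ∈ S := by
        rw [← h]
        exact Finset.mem_biUnion.2 ⟨v, Finset.mem_univ _, hc⟩
      obtain ⟨a, rfl⟩ := (hf c).1 this
      exact ⟨a, hc, rfl⟩
  refine Nat.card_congr
    { toFun := fun τ => ⟨fun a => Finset.univ.filter fun v => f a ∈ τ.1.1 v, ?_, ?_⟩
      invFun := fun P => ⟨⟨fun v => (Finset.univ.filter fun a => v ∈ P.1 a).map f, ?_, ?_⟩, ?_⟩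
      left_inv := ?_
      right_inv := ?_ }
  · obtain ⟨⟨τ, h1, h2⟩, h3⟩ := τ
    intro a
    constructor
    · have : f a ∈ Finset.univ.biUnion τ := by
        rw [h3]
        exact (hf _).2 ⟨a, rfl⟩
      obtain ⟨v, _, hv⟩ := Finset.mem_biUnion.1 this
      exact ⟨v, by simpa using hv⟩
    · intro u hu v hv huv
      simp only [Finset.mem_filter, Finset.mem_univ, true_and] at hu hv
      have := Finset.mem_inter.2 ⟨hu, hv⟩
      rw [h2 u v huv] at this
      simp at this
  · obtain ⟨⟨τ, h1, h2⟩, h3⟩ := τ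
    intro v
    rw [← h1 v, ← key τ h3 v, Finset.card_map]
    simp
  · intro v
    rw [Finset.card_map]
    exact P.2.2 v
  · intro u v huv
    rw [Finset.eq_empty_iff_forall_notMem]
    intro c hc
    simp only [Finset.mem_inter, Finset.mem_map, Finset.mem_filter, Finset.mem_univ,
      true_and] at hc
    obtain ⟨⟨a, ha, rfl⟩, b, hb, hab⟩ := hc
    obtain rfl := f.injective hab
    exact (P.2.1 b).2 u ha v hb huv
  · ext c
    rw [hf]
    simp only [Finset.mem_biUnion, Finset.mem_map, Finset.mem_filter, Finset.mem_univ, true_and]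
    constructor
    · rintro ⟨v, a, _, h⟩
      exact ⟨a, h⟩
    · rintro ⟨a, h⟩
      obtain ⟨v, hv⟩ := (P.2.1 a).1
      exact ⟨v, a, hv, h⟩
  · rintro ⟨⟨τ, h1, h2⟩, h3⟩
    apply Subtype.ext
    apply Subtype.ext
    funext v
    simpa using key τ h3 v
  · rintro ⟨P, h1, h2⟩
    apply Subtype.ext
    funext a
    ext v
    simp

/-- The number of proper `k`-multicolorings of `G` with `q` colors is
`∑_j N_j * (q choose j)`, where `N_j` is the number of ordered `j`-tuples
`(P_1, …, P_j)` of nonempty independent subsets of the vertex set such that every vertex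
`v` belongs to exactly `k v` of them (and `N_j = 0` for `j > ∑ v, k v`). -/
theorem stmt6 {V : Type*} [Fintype V] (G : SimpleGraph V) (k : V → ℕ)
    (N : ℕ → ℕ)
    (hN : ∀ j : ℕ, N j = Nat.card {P : Fin j → Finset V //
        (∀ a, (P a).Nonempty ∧ ∀ u ∈ P a, ∀ v ∈ P a, ¬ G.Adj u v) ∧
        ∀ v, (Finset.univ.filter fun a => v ∈ P a).card = k v}) :
    ∀ q : ℕ,
      Nat.card {τ : V → Finset (Fin q) //
          (∀ v, (τ v).card = k v) ∧ ∀ u v, G.Adj u v → τ u ∩ τ v = ∅}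
        = ∑ j ∈ Finset.range (∑ v, k v + 1), N j * q.choose j := by
  intro q
  have hz : ∀ j, ∑ v, k v < j → N j = 0 := by
    intro j hj
    rw [hN, Nat.card_eq_zero]
    left
    constructor
    rintro ⟨P, h1, h2⟩
    exact absurd (aux_zero G k j P h1 h2) (by omega)
  have h1 : Nat.card {τ : V → Finset (Fin q) //
          (∀ v, (τ v).card = k v) ∧ ∀ u v, G.Adj u v → τ u ∩ τ v = ∅}
      = ∑ S : Finset (Fin q), N S.card := by
    rw [Nat.card_congr (Equiv.sigmaFiberEquiv (fun τ : {τ : V → Finset (Fin q) //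
          (∀ v, (τ v).card = k v) ∧ ∀ u v, G.Adj u v → τ u ∩ τ v = ∅} =>
          Finset.univ.biUnion τ.1)).symm, Nat.card_sigma]
    refine Finset.sum_congr rfl fun S _ => ?_
    rw [hN]
    exact aux_equiv G k q S
  have h2 : ∑ S : Finset (Fin q), N S.card = ∑ j ∈ Finset.range (q + 1), N j * q.choose j := by
    rw [← Finset.powerset_univ, Finset.sum_powerset_apply_card]
    simp [mul_comm]
  rw [h1, h2]
  have h3 : ∀ m, m ≤ max q (∑ v, k v) → (∀ j, m < j → N j * q.choose j = 0) →
      ∑ j ∈ Finset.range (m + 1), N j * q.choose j =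
        ∑ j ∈ Finset.range (max q (∑ v, k v) + 1), N j * q.choose j := by
    intro m hm h
    apply Finset.sum_subset
    · intro x hx
      simp only [Finset.mem_range] at *
      omega
    · intro x _ hx
      apply h
      simp only [Finset.mem_range] at hx
      omega
  rw [h3 q (le_max_left _ _), h3 (∑ v, k v) (le_max_right _ _)]
  · intro j hj
    rw [hz j hj, zero_mul]
  · intro j hj
    rw [Nat.choose_eq_zero_of_lt hj, mul_zero]
end

section
/- Let G be a simple graph on a finite vertex type V and let k : V → ℕ. Then there exists a polynomial P ∈ ℚ[q] of degree at most Σ_{v ∈ V} k v such that for every natural number q, P evaluated at q equals π_k^G(q), the number of proper k-multicolorings of G with color set Fin q; that is, the number of proper k-multicolorings with q colors is a polynomial function of q (the generalized chromatic polynomial of G). -/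
open scoped Classical

/-- The finset of proper multicolorings with `q` colors. -/
noncomputable def mcol {V : Type*} [Fintype V] (G : SimpleGraph V) (k : V → ℕ) (q : ℕ) :
    Finset (V → Finset (Fin q)) :=
  Finset.univ.filter fun τ => (∀ v, (τ v).card = k v) ∧ ∀ u v, G.Adj u v → τ u ∩ τ v = ∅

/-- The number of proper multicolorings using all of the `n` colors. -/
noncomputable def surjCount {V : Type*} [Fintype V] (G : SimpleGraph V) (k : V → ℕ) (n : ℕ) : ℕ :=
  ((mcol G k n).filter fun τ => Finset.univ.biUnion τ = Finset.univ).card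

theorem fiber_card {V : Type*} [Fintype V] (G : SimpleGraph V) (k : V → ℕ) (q : ℕ)
    (S : Finset (Fin q)) :
    ((mcol G k q).filter fun τ => Finset.univ.biUnion τ = S).card = surjCount G k S.card := by
  symm
  let e : Fin S.card ↪ Fin q := (S.orderEmbOfFin rfl).toEmbedding
  have he : Finset.univ.map e = S := by
    ext x
    have := Finset.range_orderEmbOfFin S (rfl : S.card = S.card)
    have h2 := Set.ext_iff.1 this x
    simpa [e] using h2
  unfold surjCount
  refine Finset.card_bij (fun τ _ v => (τ v).map e) ?_ ?_ ?_
  · intro τ hτ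
    simp only [mcol, Finset.mem_filter, Finset.mem_univ, true_and] at hτ ⊢
    obtain ⟨⟨h1, h2⟩, h3⟩ := hτ
    refine ⟨⟨fun v => by simpa using h1 v, fun u v h => ?_⟩, ?_⟩
    · rw [← Finset.map_inter, h2 u v h, Finset.map_empty]
    · refine Eq.trans ?_ he
      rw [← h3]
      ext x
      simp only [Finset.mem_biUnion, Finset.mem_map, Finset.mem_univ, true_and]
      constructor
      · rintro ⟨v, a, ha, rfl⟩
        exact ⟨a, ⟨v, ha⟩, rfl⟩
      · rintro ⟨a, ⟨v, ha⟩, rfl⟩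
        exact ⟨v, a, ha, rfl⟩
  · intro a _ b _ h
    funext v
    exact Finset.map_injective e (congrFun h v)
  · intro τ hτ
    simp only [mcol, Finset.mem_filter, Finset.mem_univ, true_and] at hτ
    obtain ⟨⟨h1, h2⟩, h3⟩ := hτ
    have hsub : ∀ v, ∃ t : Finset (Fin S.card), t.map e = τ v := by
      intro v
      have : τ v ⊆ Finset.univ.map e := by
        rw [he, ← h3]
        exact Finset.subset_biUnion_of_mem τ (Finset.mem_univ v)
      obtain ⟨t, _, ht⟩ := Finset.subset_map_iff.1 this
      exact ⟨t, ht.symm⟩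
    choose t ht using hsub
    refine ⟨t, ?_, funext ht⟩
    simp only [mcol, Finset.mem_filter, Finset.mem_univ, true_and]
    refine ⟨⟨fun v => by rw [← h1 v, ← ht v, Finset.card_map], fun u v h => ?_⟩, ?_⟩
    · have := h2 u v h
      rwa [← ht u, ← ht v, ← Finset.map_inter, Finset.map_eq_empty] at this
    · ext x
      simp only [Finset.mem_biUnion, Finset.mem_univ, true_and, iff_true]
      have hx : e x ∈ Finset.univ.biUnion τ := by
        rw [h3]
        exact he.subset (Finset.mem_map_of_mem e (Finset.mem_univ x))
      simp only [Finset.mem_biUnion, Finset.mem_univ, true_and] at hx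
      obtain ⟨v, hv⟩ := hx
      rw [← ht v, Finset.mem_map'] at hv
      exact ⟨v, hv⟩

theorem surjCount_eq_zero {V : Type*} [Fintype V] (G : SimpleGraph V) (k : V → ℕ) (n : ℕ)
    (hn : ∑ v, k v < n) : surjCount G k n = 0 := by
  unfold surjCount
  rw [Finset.card_eq_zero, Finset.filter_eq_empty_iff]
  intro τ hτ h
  simp only [mcol, Finset.mem_filter, Finset.mem_univ, true_and] at hτ
  have h1 : (Finset.univ.biUnion τ).card ≤ ∑ v, (τ v).card := Finset.card_biUnion_le
  rw [h] at h1
  simp only [hτ.1, Finset.card_univ, Fintype.card_fin] at h1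
  omega

theorem mcol_card {V : Type*} [Fintype V] (G : SimpleGraph V) (k : V → ℕ) (q : ℕ) :
    (mcol G k q).card = ∑ j ∈ Finset.range (∑ v, k v + 1), q.choose j * surjCount G k j := by
  rw [Finset.card_eq_sum_card_fiberwise (f := fun τ => Finset.univ.biUnion τ)
    (t := (Finset.univ : Finset (Fin q)).powerset) (fun _ _ => by simp)]
  simp only [fiber_card]
  rw [Finset.sum_powerset_apply_card (surjCount G k)]
  simp only [Finset.card_univ, Fintype.card_fin, smul_eq_mul]
  have hA : ∀ a b, a ≤ b → (∀ j, a ≤ j → q.choose j * surjCount G k j = 0) →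
      ∑ j ∈ Finset.range a, q.choose j * surjCount G k j =
      ∑ j ∈ Finset.range b, q.choose j * surjCount G k j := by
    intro a b hab h
    apply Finset.sum_subset (Finset.range_mono hab)
    intro j _ hj
    exact h j (by simpa using hj)
  rw [hA (q + 1) (q + 1 + (∑ v, k v + 1)) (by omega)
      (fun j hj => by rw [Nat.choose_eq_zero_of_lt (by omega), zero_mul]),
    hA (∑ v, k v + 1) (q + 1 + (∑ v, k v + 1)) (by omega)
      (fun j hj => by rw [surjCount_eq_zero G k j (by omega), mul_zero])]

/-- The number of proper `k`-multicolorings of `G` with `q` colors is a polynomial function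
of `q`, of degree at most `∑ v, k v` (the generalized chromatic polynomial of `G`). -/
theorem stmt7 {V : Type*} [Fintype V] (G : SimpleGraph V) (k : V → ℕ) :
    ∃ P : Polynomial ℚ, P.natDegree ≤ ∑ v, k v ∧
      ∀ q : ℕ, P.eval (q : ℚ) =
        Nat.card {τ : V → Finset (Fin q) //
          (∀ v, (τ v).card = k v) ∧ ∀ u v, G.Adj u v → τ u ∩ τ v = ∅} := by
  refine ⟨∑ j ∈ Finset.range (∑ v, k v + 1),
    Polynomial.C ((surjCount G k j : ℚ) / (j.factorial : ℚ)) * descPochhammer ℚ j, ?_, ?_⟩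
  · apply Polynomial.natDegree_sum_le_of_forall_le
    intro j hj
    refine (Polynomial.natDegree_C_mul_le _ _).trans ?_
    rw [descPochhammer_natDegree]
    have := Finset.mem_range.1 hj
    omega
  · intro q
    have hc : Nat.card {τ : V → Finset (Fin q) //
          (∀ v, (τ v).card = k v) ∧ ∀ u v, G.Adj u v → τ u ∩ τ v = ∅} = (mcol G k q).card := by
      rw [Nat.card_eq_fintype_card, Fintype.card_subtype]
      rfl
    rw [hc, mcol_card, Polynomial.eval_finsetSum]
    push_cast
    refine Finset.sum_congr rfl fun j _ => ?_
    rw [Polynomial.eval_mul, Polynomial.eval_C, descPochhammer_eval_eq_descFactorial,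
      Nat.descFactorial_eq_factorial_mul_choose]
    have : (j.factorial : ℚ) ≠ 0 := by exact_mod_cast j.factorial_ne_zero
    push_cast
    field_simp
end

section
/- Let G be a simple graph on a finite vertex type V, let k : V → ℕ, and let d : ℕ → ℕ be finitely supported. Then the coefficient of the monomial ∏_i x_i^(d i) in the k-chromatic symmetric function X_k^G equals the number of families (P_i)_{i ∈ supp(d)} of independent subsets of V, indexed by the support of d, such that |P_i| = d i for every i ∈ supp(d) and every vertex v belongs to exactly k v of the sets P_i. -/
open scoped Classical

/-- The coefficient of `∏ i, x_i ^ d i` in the `k`-chromatic symmetric function `X_k^G`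
(the number of proper `k`-multicolorings `τ : V → Finset ℕ` of `G` with
`|{v : i ∈ τ v}| = d i` for all `i`) equals the number of families `(P_i)_{i ∈ supp d}` of
independent subsets of `V` with `|P_i| = d i` such that every vertex `v` belongs to
exactly `k v` of the sets `P_i`. -/
theorem stmt9 {V : Type*} [Fintype V] (G : SimpleGraph V) (k : V → ℕ) (d : ℕ →₀ ℕ) :
    Nat.card {τ : V → Finset ℕ //
        (∀ v, (τ v).card = k v) ∧
        (∀ u v, G.Adj u v → τ u ∩ τ v = ∅) ∧
        ∀ i : ℕ, (Finset.univ.filter fun v => i ∈ τ v).card = d i}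
      = Nat.card {P : ↥d.support → Finset V //
          (∀ i : ↥d.support, (∀ u ∈ P i, ∀ v ∈ P i, ¬ G.Adj u v) ∧ (P i).card = d i.1) ∧
          ∀ v, (Finset.univ.filter fun i : ↥d.support => v ∈ P i).card = k v} := by
  have supp : ∀ τ : V → Finset ℕ,
      (∀ i : ℕ, (Finset.univ.filter fun v => i ∈ τ v).card = d i) →
      ∀ v i, i ∈ τ v → i ∈ d.support := by
    intro τ h v i hi
    rw [Finsupp.mem_support_iff, ← h i]
    exact Finset.card_ne_zero_of_mem (a := v) (by simpa using hi)
  have back : ∀ τ : V → Finset ℕ,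
      (∀ i : ℕ, (Finset.univ.filter fun v => i ∈ τ v).card = d i) →
      ∀ v, ((Finset.univ.filter fun i : ↥d.support => i.1 ∈ τ v).map
        (Function.Embedding.subtype _)) = τ v := by
    intro τ h v
    ext i
    simp only [Finset.mem_map, Finset.mem_filter, Finset.mem_univ, true_and,
      Function.Embedding.subtype_apply]
    constructor
    · rintro ⟨j, hj, rfl⟩
      exact hj
    · intro hi
      exact ⟨⟨i, supp τ h v i hi⟩, hi, rfl⟩
  have mem : ∀ (P : ↥d.support → Finset V) (v : V) (i : ℕ),
      i ∈ ((Finset.univ.filter fun i : ↥d.support => v ∈ P i).map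
        (Function.Embedding.subtype _)) ↔ ∃ h : i ∈ d.support, v ∈ P ⟨i, h⟩ := by
    intro P v i
    simp only [Finset.mem_map, Finset.mem_filter, Finset.mem_univ, true_and,
      Function.Embedding.subtype_apply]
    constructor
    · rintro ⟨j, hj, rfl⟩
      exact ⟨j.2, hj⟩
    · rintro ⟨h, hi⟩
      exact ⟨⟨i, h⟩, hi, rfl⟩
  refine Nat.card_congr
    { toFun := fun τ => ⟨fun i => Finset.univ.filter fun v => i.1 ∈ τ.1 v, ?_, ?_⟩
      invFun := fun P => ⟨fun v => (Finset.univ.filter fun i : ↥d.support => v ∈ P.1 i).map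
        (Function.Embedding.subtype _), ?_, ?_, ?_⟩
      left_inv := ?_
      right_inv := ?_ }
  · intro i
    refine ⟨?_, τ.2.2.2 i.1⟩
    intro u hu v hv huv
    have h := τ.2.2.1 u v huv
    have h2 : i.1 ∈ τ.1 u ∩ τ.1 v :=
      Finset.mem_inter.2 ⟨(Finset.mem_filter.1 hu).2, (Finset.mem_filter.1 hv).2⟩
    rw [h] at h2
    exact absurd h2 (Finset.notMem_empty _)
  · intro v
    rw [← τ.2.1 v, ← back τ.1 τ.2.2.2 v, Finset.card_map]
    simp [back τ.1 τ.2.2.2]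
  · intro v
    rw [Finset.card_map]
    exact P.2.2 v
  · intro u v huv
    ext i
    simp only [Finset.mem_inter, mem, Finset.notMem_empty, iff_false]
    rintro ⟨⟨h, hu⟩, ⟨_, hv⟩⟩
    exact (P.2.1 ⟨i, h⟩).1 u hu v hv huv
  · intro i
    simp only [mem]
    by_cases h : i ∈ d.support
    · rw [← (P.2.1 ⟨i, h⟩).2]
      congr 1
      ext v
      simp only [Finset.mem_filter, Finset.mem_univ, true_and]
      exact ⟨fun ⟨_, a⟩ => a, fun a => ⟨h, a⟩⟩
    · rw [Finsupp.notMem_support_iff.1 h, Finset.card_eq_zero]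
      ext v
      simp only [Finset.mem_filter, Finset.mem_univ, true_and, Finset.notMem_empty, iff_false]
      exact fun ⟨a, _⟩ => h a
  · intro τ
    apply Subtype.ext
    funext v
    ext i
    rw [mem]
    simp only [Finset.mem_filter, Finset.mem_univ, true_and]
    exact ⟨fun ⟨_, a⟩ => a, fun a => ⟨supp τ.1 τ.2.2.2 v i a, a⟩⟩
  · intro P
    apply Subtype.ext
    funext i
    ext v
    simp only [Finset.mem_filter, Finset.mem_univ, true_and, mem]
    exact ⟨fun ⟨_, a⟩ => a, fun a => ⟨i.2, a⟩⟩
end
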